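/- For every real α > −1, the series Σ_{i=1}^∞ c_i^*(α,1) converges and equals 2·₁F₁(−α−1; 3; −2). -/

import Mathlib

open Finset

/-- Generalized binomial coefficient `C(z, k)` for real `z` and integer `k`,
equal to `z (z-1) ⋯ (z-k+1) / k!` for `k ≥ 0` and `0` for `k < 0`. -/
noncomputable def gbinom (z : ℝ) (k : ℤ) : ℝ :=
  if 0 ≤ k then (∏ j ∈ Finset.range k.toNat, (z - (j : ℝ))) / (Nat.factorial k.toNat : ℝ)
  else 0

/-- Pochhammer symbol `(z)_k = z (z+1) ⋯ (z+k-1)`. -/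
noncomputable def poch (z : ℝ) (k : ℕ) : ℝ :=
  ∏ j ∈ Finset.range k, (z + (j : ℝ))

/-- Classical Laguerre polynomial `L_n^α(x) = ∑_{k=0}^n (-1)^k C(n+α, n-k) x^k / k!`. -/
noncomputable def laguerre (α : ℝ) (n : ℕ) (x : ℝ) : ℝ :=
  ∑ k ∈ Finset.range (n + 1),
    (-1 : ℝ) ^ k * gbinom ((n : ℝ) + α) ((n : ℤ) - (k : ℤ)) * x ^ k / (Nat.factorial k : ℝ)

/-- The coefficient functions `a_i(α, x)` for `i ≥ 1`. -/
noncomputable def aFun (α : ℝ) (i : ℕ) (x : ℝ) : ℝ :=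
  (1 / (Nat.factorial i : ℝ)) * ∑ j ∈ Finset.Icc 1 i,
    (-1 : ℝ) ^ (i + j + 1) * gbinom (α + 1) ((j : ℤ) - 1) *
      gbinom (α + 2) ((i : ℤ) - (j : ℤ)) * poch (α + 3) (i - j) * x ^ j

/-- The Gauss hypergeometric series `₂F₁(a, b; c; z) = ∑_{k=0}^∞ (a)_k (b)_k z^k / ((c)_k k!)`
(used here only with `a` a nonpositive integer, so the series terminates). -/
noncomputable def hyp2F1 (a b c z : ℝ) : ℝ :=
  ∑' k : ℕ, poch a k * poch b k * z ^ k / (poch c k * (Nat.factorial k : ℝ))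

/-- The confluent hypergeometric series `₁F₁(a; b; z) = ∑_{k=0}^∞ (a)_k z^k / ((b)_k k!)`. -/
noncomputable def hyp1F1 (a b z : ℝ) : ℝ :=
  ∑' k : ℕ, poch a k * z ^ k / (poch b k * (Nat.factorial k : ℝ))

/-- `c_{2i}^*(α,x) = (4(-1)^{i+1}/(2i)!) C(α+1, i-1) ₂F₁(-i+1, α+5/2-i; 1/2; x²)` for `i ≥ 1`. -/
noncomputable def cStarEven (α : ℝ) (i : ℕ) (x : ℝ) : ℝ :=
  (4 * (-1 : ℝ) ^ (i + 1) / (Nat.factorial (2 * i) : ℝ)) * gbinom (α + 1) ((i : ℤ) - 1) *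
    hyp2F1 (-(i : ℝ) + 1) (α + 5 / 2 - (i : ℝ)) (1 / 2) (x ^ 2)

/-- `c_{2i+1}^*(α,x) = (8(-1)^{i+1}/(2i+1)!) C(α, i-1) (α+1) x ₂F₁(-i+1, α+5/2-i; 3/2; x²)`
for `i ≥ 1`. -/
noncomputable def cStarOdd (α : ℝ) (i : ℕ) (x : ℝ) : ℝ :=
  (8 * (-1 : ℝ) ^ (i + 1) / (Nat.factorial (2 * i + 1) : ℝ)) * gbinom α ((i : ℤ) - 1) *
    (α + 1) * x * hyp2F1 (-(i : ℝ) + 1) (α + 5 / 2 - (i : ℝ)) (3 / 2) (x ^ 2)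

/-- The functions `c_m^*(α,x)`: equal to `c_{2i}^*` for `m = 2i`, to `0` for `m = 1`,
and to `c_{2i+1}^*` for odd `m = 2i+1 ≥ 3`. -/
noncomputable def cS (α : ℝ) (m : ℕ) (x : ℝ) : ℝ :=
  if m = 1 then 0
  else if m % 2 = 0 then cStarEven α (m / 2) x
  else cStarOdd α (m / 2) x

lemma poch_zero (z : ℝ) : poch z 0 = 1 := by simp [poch]

lemma poch_succ (z : ℝ) (k : ℕ) : poch z (k + 1) = poch z k * (z + k) :=
  Finset.prod_range_succ _ _

lemma poch_add (z : ℝ) (m n : ℕ) : poch z (m + n) = poch z m * poch (z + m) n := by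
  simp only [poch, Finset.prod_range_add, Nat.cast_add, add_assoc]

lemma poch_succ' (z : ℝ) (k : ℕ) : poch z (k + 1) = z * poch (z + 1) k := by
  rw [add_comm k 1, poch_add]
  simp [poch]

lemma poch_pos {z : ℝ} (hz : 0 < z) (k : ℕ) : 0 < poch z k :=
  Finset.prod_pos fun _ _ => by positivity

lemma poch_neg_natCast (n k : ℕ) :
    poch (-(n : ℝ)) k = (-1) ^ k * (Nat.factorial k * Nat.choose n k) := by
  rw [← Nat.cast_mul, ← Nat.descFactorial_eq_factorial_mul_choose]
  induction k with
  | zero => simp [poch_zero]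
  | succ k ih =>
    rw [poch_succ, ih, Nat.descFactorial_succ]
    rcases le_or_gt k n with h | h
    · push_cast [Nat.cast_sub h]
      ring
    · simp [Nat.descFactorial_eq_zero_iff_lt.2 h]

lemma gbinom_natCast (z : ℝ) (n : ℕ) :
    gbinom z n = (-1) ^ n * poch (-z) n / Nat.factorial n := by
  simp only [gbinom, Int.natCast_nonneg, if_true, Int.toNat_natCast, poch]
  rw [← Finset.card_range n, ← Finset.prod_const, Finset.card_range, ← Finset.prod_mul_distrib]
  congr 1
  exact Finset.prod_congr rfl fun _ _ => by ring

/-- Pascal's rule for binomially weighted sums. -/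
lemma sum_choose_succ_mul' (f : ℕ → ℝ) (n : ℕ) :
    ∑ k ∈ Finset.range (n + 2), (Nat.choose (n + 1) k : ℝ) * f k =
      ∑ k ∈ Finset.range (n + 1), (Nat.choose n k : ℝ) * f k +
        ∑ k ∈ Finset.range (n + 1), (Nat.choose n k : ℝ) * f (k + 1) := by
  have h : ∑ k ∈ Finset.range (n + 1), (Nat.choose n k : ℝ) * f k =
      ∑ k ∈ Finset.range (n + 2), (Nat.choose n k : ℝ) * f k := by
    rw [Finset.sum_range_succ _ (n + 1)]
    simp
  rw [h, Finset.sum_range_succ', Finset.sum_range_succ' _ (n + 1)]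
  simp only [Nat.choose_succ_succ, Nat.cast_add, add_mul, Finset.sum_add_distrib,
    Nat.choose_zero_right]
  ring

lemma sum_choose_mul_poch_div (n : ℕ) (b : ℝ) {c : ℝ} (hc : 0 < c) :
    ∑ k ∈ Finset.range (n + 1), (Nat.choose n k : ℝ) * ((-1) ^ k * poch b k / poch c k) =
      poch (c - b) n / poch c n := by
  induction n generalizing b c with
  | zero => simp [poch_zero]
  | succ n ih =>
    have hstep : ∀ k, (-1 : ℝ) ^ (k + 1) * poch b (k + 1) / poch c (k + 1) =
        -(b / c) * ((-1) ^ k * poch (b + 1) k / poch (c + 1) k) := fun k => by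
      have := (poch_pos (show 0 < c + 1 by linarith) k).ne'
      rw [poch_succ', poch_succ' c]
      field_simp
      ring
    rw [sum_choose_succ_mul', ih b hc]
    simp only [hstep, mul_left_comm _ (-(b / c))]
    rw [← Finset.mul_sum, ih (b + 1) (show 0 < c + 1 by linarith),
      show c + 1 - (b + 1) = c - b by ring]
    have h1 := poch_succ c n
    rw [poch_succ'] at h1
    have h0 : poch (c + 1) n = poch c n * (c + n) / c := by
      rw [← h1]; field_simp
    have := (poch_pos hc n).ne'
    have : c + n ≠ 0 := by positivity
    rw [h0, poch_succ, poch_succ]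
    field_simp
    ring

/-- The Chu–Vandermonde identity. -/
lemma hyp2F1_neg_natCast_one (n : ℕ) (b : ℝ) {c : ℝ} (hc : 0 < c) :
    hyp2F1 (-(n : ℝ)) b c 1 = poch (c - b) n / poch c n := by
  rw [← sum_choose_mul_poch_div n b hc, hyp2F1]
  have hterm : ∀ k, poch (-(n : ℝ)) k * poch b k * 1 ^ k / (poch c k * (Nat.factorial k : ℝ)) =
      (Nat.choose n k : ℝ) * ((-1) ^ k * poch b k / poch c k) := fun k => by
    have := (poch_pos hc k).ne'
    have : (Nat.factorial k : ℝ) ≠ 0 := by positivity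
    rw [poch_neg_natCast]
    field_simp
    simp
  simp only [hterm]
  refine tsum_eq_sum fun k hk => ?_
  rw [Nat.choose_eq_zero_of_lt (by rw [Finset.mem_range] at hk; omega)]
  simp

lemma factorial_mul_poch_half (n : ℕ) :
    4 ^ n * ((Nat.factorial n : ℝ) * poch (1 / 2) n) = Nat.factorial (2 * n) := by
  induction n with
  | zero => simp [poch_zero]
  | succ n ih =>
    rw [poch_succ, show 2 * (n + 1) = 2 * n + 1 + 1 by ring, Nat.factorial_succ,
      Nat.factorial_succ, Nat.factorial_succ]
    push_cast
    rw [← ih]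
    ring

lemma factorial_mul_poch_three_halves (n : ℕ) :
    4 ^ n * ((Nat.factorial n : ℝ) * poch (3 / 2) n) = Nat.factorial (2 * n + 1) := by
  induction n with
  | zero => simp [poch_zero]
  | succ n ih =>
    rw [poch_succ, show 2 * (n + 1) + 1 = 2 * n + 1 + 1 + 1 by ring, Nat.factorial_succ,
      Nat.factorial_succ (2 * n + 1 + 1), Nat.factorial_succ (2 * n + 1)]
    push_cast
    rw [← ih]
    ring

lemma poch_three (k : ℕ) : poch 3 k = (Nat.factorial (k + 2) : ℝ) / 2 := by
  induction k with
  | zero => simp [poch_zero]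
  | succ k ih =>
    rw [poch_succ, ih, show k + 1 + 2 = k + 2 + 1 by ring, Nat.factorial_succ (k + 2)]
    push_cast
    ring

lemma neg_one_pow_mul_self (n : ℕ) : (-1 : ℝ) ^ n * (-1) ^ n = 1 := by
  rw [← mul_pow]; simp

lemma cStarEven_one (α : ℝ) (n : ℕ) :
    cStarEven α (n + 1) 1 = 2 * (poch (-α - 1) (2 * n) * (-2) ^ (2 * n) /
      (poch 3 (2 * n) * Nat.factorial (2 * n))) := by
  have hb : (1 / 2 : ℝ) - (α + 5 / 2 - ((n + 1 : ℕ) : ℝ)) = -α - 1 + n := by push_cast; ring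
  rw [cStarEven, show -((n + 1 : ℕ) : ℝ) + 1 = -(n : ℝ) by push_cast; ring, one_pow,
    hyp2F1_neg_natCast_one n _ (by norm_num), hb,
    show ((n + 1 : ℕ) : ℤ) - 1 = (n : ℤ) by push_cast; ring, gbinom_natCast, poch_three,
    ← factorial_mul_poch_half n, two_mul n, poch_add, show 2 * (n + 1) = n + n + 2 by ring,
    show -(α + 1) = -α - 1 by ring, ← two_mul n, pow_mul]
  have := (poch_pos (show (0 : ℝ) < 1 / 2 by norm_num) n).ne'
  have : (Nat.factorial n : ℝ) ≠ 0 := by positivity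
  have : (Nat.factorial (2 * n + 2) : ℝ) ≠ 0 := by positivity
  have hs := neg_one_pow_mul_self n
  rw [show (-2 : ℝ) ^ 2 = 4 by norm_num, pow_succ (-1 : ℝ) (n + 1), pow_succ (-1 : ℝ) n]
  field_simp
  linear_combination (4 * poch (-α - 1) n * poch (-α - 1 + n) n) * hs

lemma cStarOdd_one (α : ℝ) (n : ℕ) :
    cStarOdd α (n + 1) 1 = 2 * (poch (-α - 1) (2 * n + 1) * (-2) ^ (2 * n + 1) /
      (poch 3 (2 * n + 1) * Nat.factorial (2 * n + 1))) := by
  have hb : (3 / 2 : ℝ) - (α + 5 / 2 - ((n + 1 : ℕ) : ℝ)) = -α + n := by push_cast; ring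
  rw [cStarOdd, show -((n + 1 : ℕ) : ℝ) + 1 = -(n : ℝ) by push_cast; ring, one_pow,
    hyp2F1_neg_natCast_one n _ (by norm_num), hb,
    show ((n + 1 : ℕ) : ℤ) - 1 = (n : ℤ) by push_cast; ring, gbinom_natCast, poch_three,
    ← factorial_mul_poch_three_halves n, poch_succ', show -α - 1 + 1 = -α by ring, two_mul n,
    poch_add, show 2 * (n + 1) + 1 = n + n + 1 + 2 by ring, ← two_mul n, pow_succ (-2 : ℝ), pow_mul]
  have := (poch_pos (show (0 : ℝ) < 3 / 2 by norm_num) n).ne'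
  have : (Nat.factorial n : ℝ) ≠ 0 := by positivity
  have : (Nat.factorial (2 * n + 1 + 2) : ℝ) ≠ 0 := by positivity
  have hs := neg_one_pow_mul_self n
  rw [show (-2 : ℝ) ^ 2 = 4 by norm_num, pow_succ (-1 : ℝ) (n + 1), pow_succ (-1 : ℝ) n]
  field_simp
  linear_combination (8 * (α + 1) * poch (-α) n * poch (-α + n) n) * hs

lemma cS_add_two_one (α : ℝ) (k : ℕ) :
    cS α (k + 2) 1 =
      2 * (poch (-α - 1) k * (-2) ^ k / (poch 3 k * Nat.factorial k)) := by
  rw [cS, if_neg (by omega)]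
  obtain ⟨n, rfl | rfl⟩ := k.even_or_odd'
  · rw [if_pos (by omega), show (2 * n + 2) / 2 = n + 1 by omega, cStarEven_one]
  · rw [if_neg (by omega), show (2 * n + 1 + 2) / 2 = n + 1 by omega, cStarOdd_one]

lemma summable_hyp1F1_three (a z : ℝ) :
    Summable fun k : ℕ => poch a k * z ^ k / (poch 3 k * (Nat.factorial k : ℝ)) := by
  refine summable_of_ratio_norm_eventually_le (r := 1 / 2) (by norm_num) ?_
  filter_upwards [Filter.eventually_ge_atTop ⌈2 * |z| * (|a| + 1)⌉₊] with k hk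
  have hk' : 2 * |z| * (|a| + 1) ≤ k := Nat.ceil_le.1 hk
  have h3 := poch_pos (show (0 : ℝ) < 3 by norm_num) k
  have hf : (0 : ℝ) < Nat.factorial k := by positivity
  have hk0 : (0 : ℝ) ≤ k := by positivity
  have hratio : poch a (k + 1) * z ^ (k + 1) / (poch 3 (k + 1) * (Nat.factorial (k + 1) : ℝ)) =
      ((a + k) * z / ((3 + k) * (k + 1))) *
        (poch a k * z ^ k / (poch 3 k * (Nat.factorial k : ℝ))) := by
    rw [poch_succ, poch_succ, Nat.factorial_succ, pow_succ]
    push_cast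
    field_simp
  rw [hratio, norm_mul]
  refine mul_le_mul_of_nonneg_right ?_ (norm_nonneg _)
  rw [Real.norm_eq_abs, abs_div, abs_mul, abs_of_pos (show (0 : ℝ) < (3 + k) * (k + 1) by positivity),
    div_le_iff₀ (by positivity)]
  have h1 : |a + k| ≤ |a| + k := (abs_add_le a k).trans_eq (by rw [abs_of_nonneg hk0])
  have h2 : |a| + k ≤ (|a| + 1) * (k + 1) := by nlinarith [abs_nonneg a]
  have h4 : |a + k| * |z| ≤ (|a| + 1) * (k + 1) * |z| :=
    mul_le_mul_of_nonneg_right (h1.trans h2) (abs_nonneg z)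
  nlinarith [mul_le_mul_of_nonneg_right hk' (show (0 : ℝ) ≤ k + 1 by positivity)]

/-- `∑_{i=1}^∞ c_i^*(α,1) = 2 ₁F₁(-α-1; 3; -2)`. -/
theorem statement18 (α : ℝ) (hα : -1 < α) :
    HasSum (fun m : ℕ => cS α (m + 1) 1) (2 * hyp1F1 (-α - 1) 3 (-2)) := by
  have h0 : cS α (0 + 1) 1 = 0 := by simp [cS]
  rw [← hasSum_nat_add_iff' 1, Finset.sum_range_one, h0, sub_zero]
  simp only [add_assoc, Nat.reduceAdd, cS_add_two_one]
  exact (summable_hyp1F1_three _ _).hasSum.mul_left 2
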